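/- Let 0 < σ ≤ 1, w(x) = (1+|x|²)^{1/2}, β ∈ ℝ, 1 ≤ r < ∞, 1 ≤ q ≤ ∞, 1 ≤ p ≤ ∞, 0 ≤ a ≤ 1 with 1/p = (1−a)/r + a(1/q − 1/3), and assume additionally a < 1 if p = ∞, and (r < ∞ or q ≥ 3). Then there is a constant C (depending on p, q, r, σ, β but not on u) such that for all u ∈ C¹_c(ℝ³): ‖w^{β − (3/p)(1−σ)} u‖_p ≤ C ‖w^{β − (3/r)(1−σ)} u‖_r^{1−a} ( ‖w^{β + (1−3/q)(1−σ)} ∂u‖_q + |β| ‖w^{β−1 + (1−3/q)(1−σ)} u‖_q )^a. -/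

import Mathlib

open MeasureTheory
open scoped ENNReal
open scoped NNReal

section Interpolation

variable {α F : Type*} [MeasurableSpace α] [NormedAddCommGroup F] {μ : Measure α} {f : α → F}

theorem eLpNorm_ofReal_eq_lintegral {p : ℝ} (hp : 0 < p) (f : α → F) :
    eLpNorm f (ENNReal.ofReal p) μ = (∫⁻ x, ‖f x‖ₑ ^ p ∂μ) ^ (1 / p) := by
  rw [eLpNorm_eq_lintegral_rpow_enorm_toReal (by simpa using hp) ENNReal.ofReal_ne_top,
    ENNReal.toReal_ofReal hp.le]

theorem eLpNorm_ofReal_rpow {p : ℝ} (hp : 0 < p) (f : α → F) :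
    eLpNorm f (ENNReal.ofReal p) μ ^ p = ∫⁻ x, ‖f x‖ₑ ^ p ∂μ := by
  rw [eLpNorm_ofReal_eq_lintegral hp, ← ENNReal.rpow_mul, one_div_mul_cancel hp.ne',
    ENNReal.rpow_one]

/-- Interpolation (Lyapunov's inequality) between two finite Lebesgue exponents. -/
theorem eLpNorm_le_rpow_mul_rpow {p r s θ : ℝ} (hf : AEStronglyMeasurable f μ)
    (hp : 0 < p) (hr : 0 < r) (hs : 0 < s) (h0 : 0 ≤ θ) (h1 : θ ≤ 1)
    (h : 1 / p = (1 - θ) / r + θ / s) :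
    eLpNorm f (ENNReal.ofReal p) μ ≤
      eLpNorm f (ENNReal.ofReal r) μ ^ (1 - θ) * eLpNorm f (ENNReal.ofReal s) μ ^ θ := by
  have h1' : 0 ≤ 1 - θ := by linarith
  rw [← ENNReal.rpow_le_rpow_iff hp, ENNReal.mul_rpow_of_nonneg _ _ hp.le, eLpNorm_ofReal_rpow hp,
    eLpNorm_ofReal_eq_lintegral hr, eLpNorm_ofReal_eq_lintegral hs, ← ENNReal.rpow_mul,
    ← ENNReal.rpow_mul, ← ENNReal.rpow_mul, ← ENNReal.rpow_mul]
  have e1 : 1 / r * ((1 - θ) * p) + 1 / s * (θ * p) = 1 := by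
    have : (1 / p) * p = 1 := by field_simp
    rw [h] at this
    linear_combination this
  refine le_trans (le_of_eq (lintegral_congr fun x => ?_))
    (ENNReal.lintegral_mul_norm_pow_le (hf.enorm.pow_const r) (hf.enorm.pow_const s)
      (by positivity) (by positivity) e1)
  rw [← ENNReal.rpow_mul, ← ENNReal.rpow_mul, ← ENNReal.rpow_add_of_nonneg _ _ (by positivity)
    (by positivity)]
  congr 1
  field_simp
  ring

/-- Interpolation between a finite Lebesgue exponent and `∞`. -/
theorem eLpNorm_le_rpow_mul_rpow_top {p r : ℝ} (hr : 0 < r) (hrp : r ≤ p)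
    (hf : eLpNorm f ∞ μ ≠ ∞) :
    eLpNorm f (ENNReal.ofReal p) μ ≤
      eLpNorm f (ENNReal.ofReal r) μ ^ (r / p) * eLpNorm f ∞ μ ^ (1 - r / p) := by
  have hp : 0 < p := hr.trans_le hrp
  rw [← ENNReal.rpow_le_rpow_iff hp, ENNReal.mul_rpow_of_nonneg _ _ hp.le, eLpNorm_ofReal_rpow hp,
    ← ENNReal.rpow_mul, ← ENNReal.rpow_mul, div_mul_cancel₀ _ hp.ne', eLpNorm_ofReal_rpow hr]
  have e : (1 - r / p) * p = p - r := by field_simp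
  rw [e]
  have htop : eLpNorm f ∞ μ ^ (p - r) ≠ ∞ := ENNReal.rpow_ne_top_of_nonneg (by linarith) hf
  rw [← lintegral_mul_const' _ _ htop]
  refine lintegral_mono_ae ?_
  filter_upwards [enorm_ae_le_eLpNormEssSup f μ] with x hx
  have : ‖f x‖ₑ ^ p = ‖f x‖ₑ ^ r * ‖f x‖ₑ ^ (p - r) := by
    rw [← ENNReal.rpow_add_of_nonneg _ _ hr.le (by linarith)]; congr 1; ring
  rw [this, eLpNorm_exponent_top]
  gcongr

end Interpolation

section GagliardoNirenberg

theorem ENNReal.le_of_le_rpow_mul_rpow {N X : ℝ≥0∞} {μ : ℝ} (hN : N ≠ ∞) (h1 : μ < 1)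
    (h : N ≤ N ^ μ * X ^ (1 - μ)) : N ≤ X := by
  rcases eq_or_ne N 0 with rfl | h0
  · exact zero_le
  rw [← ENNReal.rpow_le_rpow_iff (sub_pos.2 h1)]
  have hμ0 : N ^ μ ≠ 0 := by simp [ENNReal.rpow_eq_zero_iff, h0, hN]
  have hμ1 : N ^ μ ≠ ∞ := by simp [ENNReal.rpow_eq_top_iff, h0, hN]
  refine (ENNReal.mul_le_mul_iff_right hμ0 hμ1).1 ?_
  rwa [← ENNReal.rpow_add _ _ h0 hN, add_sub_cancel, ENNReal.rpow_one]

local notation "E³" => EuclideanSpace ℝ (Fin 3)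

theorem gagliardo_nirenberg_of_lt_three {p q r a : ℝ} (hp : 0 < p) (hq : 1 ≤ q) (hq3 : q < 3)
    (hr : 0 < r) (ha0 : 0 ≤ a) (ha1 : a ≤ 1) (h : 1 / p = (1 - a) / r + a * (1 / q - 1 / 3)) :
    ∃ C : ℝ≥0, ∀ u : E³ → ℝ, ContDiff ℝ 1 u → HasCompactSupport u →
      eLpNorm u (ENNReal.ofReal p) volume ≤ C * eLpNorm u (ENNReal.ofReal r) volume ^ (1 - a) *
        eLpNorm (fderiv ℝ u) (ENNReal.ofReal q) volume ^ a := by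
  have hs : 0 < 1 / q - 1 / 3 := sub_pos.2 (one_div_lt_one_div_of_lt (by linarith) hq3)
  set s := (1 / q - 1 / 3)⁻¹ with hs_def
  have hs0 : 0 < s := inv_pos.2 hs
  refine ⟨eLpNormLESNormFDerivOfEqInnerConst (volume : Measure E³) q.toNNReal ^ a,
    fun u hu hcu => ?_⟩
  have hsob := eLpNorm_le_eLpNorm_fderiv_of_eq_inner (volume : Measure E³) hu hcu
    (p := q.toNNReal) (p' := s.toNNReal) (by simpa using hq) (by simp)
    (by rw [NNReal.coe_inv, Real.coe_toNNReal _ hs0.le, Real.coe_toNNReal _ (by linarith)]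
        simp [hs_def])
  refine (eLpNorm_le_rpow_mul_rpow hu.continuous.aestronglyMeasurable hp hr hs0 ha0 ha1
    (by rw [h, hs_def, div_inv_eq_mul])).trans ?_
  rw [ENNReal.coe_rpow_of_nonneg _ ha0, mul_comm (_ ^ a), mul_assoc,
    ← ENNReal.mul_rpow_of_nonneg _ _ ha0]
  gcongr
  exact hsob

/-- Sobolev's inequality for `|u| ^ γ` with `p = 3 γ / 2`, combined with Hölder's inequality. -/
theorem lintegral_rpow_le_mul_eLpNorm_fderiv_three {p : ℝ} (hp : 3 / 2 < p) :
    ∃ C : ℝ≥0, ∀ u : E³ → ℝ, ContDiff ℝ 1 u → HasCompactSupport u →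
      ∫⁻ x, ‖u x‖ₑ ^ p ≤ C * (∫⁻ x, ‖u x‖ₑ ^ (p - 3 / 2)) *
        eLpNorm (fderiv ℝ u) (ENNReal.ofReal 3) volume ^ (3 / 2 : ℝ) := by
  let γ : ℝ≥0 := ⟨2 * p / 3, by linarith⟩
  have hγ : (γ : ℝ) = 2 * p / 3 := rfl
  have hγ1 : (1 : ℝ) < γ := by rw [hγ]; linarith
  have hconj : Real.HolderConjugate (Module.finrank ℝ E³) (3 / 2) := by
    rw [finrank_euclideanSpace_fin, Real.holderConjugate_iff]; norm_num
  have hconj' : Real.HolderConjugate (3 / 2) 3 := by rw [Real.holderConjugate_iff]; norm_num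
  refine ⟨lintegralPowLePowLIntegralFDerivConst (volume : Measure E³) (3 / 2) *
    γ ^ (3 / 2 : ℝ), fun u hu hcu => ?_⟩
  have hcont := hu.continuous
  have hcd : Continuous (fderiv ℝ u) := hu.continuous_fderiv one_ne_zero
  have hv : ContDiff ℝ 1 (fun x => ‖u x‖ ^ (γ : ℝ)) := hu.norm_rpow hγ1
  have hcv : HasCompactSupport (fun x => ‖u x‖ ^ (γ : ℝ)) := hcu.norm.rpow_const (by linarith)
  have h1 := lintegral_pow_le_pow_lintegral_fderiv (volume : Measure E³) hv hcv hconj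
  have h2 : ∀ x, ‖‖u x‖ ^ (γ : ℝ)‖ₑ ^ (3 / 2 : ℝ) = ‖u x‖ₑ ^ p := fun x => by
    rw [Real.enorm_rpow_of_nonneg (norm_nonneg _) (by linarith), enorm_norm, ← ENNReal.rpow_mul,
      hγ]
    congr 1; ring
  simp_rw [h2] at h1
  have h3 : ∫⁻ x, ‖fderiv ℝ (fun x => ‖u x‖ ^ (γ : ℝ)) x‖ₑ ≤
      γ * ((∫⁻ x, ‖u x‖ₑ ^ (p - 3 / 2)) ^ (1 / (3 / 2) : ℝ) *
        eLpNorm (fderiv ℝ u) (ENNReal.ofReal 3) volume) := by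
    calc _ ≤ ∫⁻ x, γ * (‖u x‖ₑ ^ ((γ : ℝ) - 1) * ‖fderiv ℝ u x‖ₑ) := by
          refine lintegral_mono fun x => ?_
          rw [← mul_assoc]
          exact enorm_fderiv_norm_rpow_le (hu.differentiable one_ne_zero) hγ1
      _ = γ * ∫⁻ x, ‖u x‖ₑ ^ ((γ : ℝ) - 1) * ‖fderiv ℝ u x‖ₑ :=
          lintegral_const_mul' _ _ ENNReal.coe_ne_top
      _ ≤ _ := by
          gcongr
          refine (ENNReal.lintegral_mul_le_Lp_mul_Lq volume hconj'
            (hcont.measurable.enorm.pow_const _).aemeasurable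
            hcd.measurable.enorm.aemeasurable).trans (le_of_eq ?_)
          rw [eLpNorm_ofReal_eq_lintegral (by norm_num)]
          congr 3 with x
          rw [← ENNReal.rpow_mul, hγ]
          congr 1; ring
  refine h1.trans ?_
  grw [h3]
  rw [ENNReal.mul_rpow_of_nonneg _ _ (by norm_num), ENNReal.mul_rpow_of_nonneg _ _ (by norm_num),
    ← ENNReal.rpow_mul, ENNReal.coe_mul, ENNReal.coe_rpow_of_nonneg _ (by norm_num)]
  norm_num [mul_assoc]

theorem gagliardo_nirenberg_three {p r a : ℝ} (hr : 0 < r) (ha0 : 0 ≤ a) (ha1 : a < 1)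
    (h : 1 / p = (1 - a) / r) :
    ∃ C : ℝ≥0, ∀ u : E³ → ℝ, ContDiff ℝ 1 u → HasCompactSupport u →
      eLpNorm u (ENNReal.ofReal p) volume ≤ C * eLpNorm u (ENNReal.ofReal r) volume ^ (1 - a) *
        eLpNorm (fderiv ℝ u) (ENNReal.ofReal 3) volume ^ a := by
  have ha : 0 < 1 - a := by linarith
  have hp : 0 < p := one_div_pos.1 (h ▸ by positivity)
  have hrp : r = p * (1 - a) := by field_simp at h; linarith
  set P := p + 3 / 2 with hP
  have hP0 : 0 < P := by positivity
  obtain ⟨C, hC⟩ := lintegral_rpow_le_mul_eLpNorm_fderiv_three (p := P) (by linarith)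
  have hPr : 0 < P - r := by nlinarith
  set μ := (p - r) / (P - r) with hμ
  have hpr : 0 ≤ p - r := by nlinarith
  have hμ0 : 0 ≤ μ := by positivity
  have hμ1 : μ < 1 := by rw [hμ, div_lt_one hPr]; linarith
  have hμ1' : 1 - μ ≠ 0 := by linarith
  have hPr' : P - r ≠ 0 := hPr.ne'
  have hμP : μ * (P - r) = p - r := by rw [hμ]; field_simp
  have hμP' : (1 - μ) * (P - r) = 3 / 2 := by rw [sub_mul, hμP]; linarith
  clear_value μ P
  have e1 : 1 - P * μ / p = (1 - a) * (1 - μ) := by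
    field_simp
    apply mul_right_cancel₀ hPr'
    linear_combination -P * hμP - p * (1 - a) * hμP' + r * hP + 3 / 2 * hrp
  have e2 : 3 / 2 * (μ / p) = a * (1 - μ) := by
    field_simp
    apply mul_right_cancel₀ hPr'
    linear_combination 3 * hμP - 2 * a * p * hμP' - 3 * hrp
  refine ⟨C ^ (μ / p / (1 - μ)), fun u hu hcu => ?_⟩
  refine ENNReal.le_of_le_rpow_mul_rpow (hu.continuous.memLp_of_hasCompactSupport hcu).2.ne hμ1 ?_
  refine (eLpNorm_le_rpow_mul_rpow hu.continuous.aestronglyMeasurable hp hr hP0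
    (θ := P * μ / p) (by positivity) ?_ ?_).trans ?_
  · linarith [mul_nonneg ha.le (sub_nonneg.2 hμ1.le)]
  · rw [e1]
    field_simp
    linear_combination (1 - μ) * hrp
  have hPow := hC u hu hcu
  rw [← eLpNorm_ofReal_rpow hP0, show P - 3 / 2 = p by simp [hP], ← eLpNorm_ofReal_rpow hp] at hPow
  have e3 : P * μ / p = P * (μ / p) := by ring
  have h1μ : 0 ≤ 1 - μ := by linarith
  rw [e1, e3, ENNReal.rpow_mul _ P]
  grw [hPow]
  rw [ENNReal.mul_rpow_of_nonneg _ _ (by positivity), ENNReal.mul_rpow_of_nonneg _ _ (by positivity),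
    ENNReal.mul_rpow_of_nonneg _ _ h1μ, ENNReal.mul_rpow_of_nonneg _ _ h1μ,
    ENNReal.coe_rpow_of_nonneg _ (by positivity)]
  simp only [← ENNReal.rpow_mul]
  rw [e2, div_mul_cancel₀ _ hμ1', mul_div_cancel₀ _ hp.ne']
  apply le_of_eq
  ring

theorem enorm_le_add_lintegral_fderiv {E : Type*} [NormedAddCommGroup E] [NormedSpace ℝ E]
    {u : E → ℝ} (hu : ContDiff ℝ 1 u) (x y : E) :
    ‖u x‖ₑ ≤ ‖u (x + y)‖ₑ +
      ∫⁻ t in Set.Ioo (0 : ℝ) 1, ‖fderiv ℝ u (x + t • y)‖ₑ * ‖y‖ₑ := by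
  have hcd : Continuous (fderiv ℝ u) := hu.continuous_fderiv one_ne_zero
  have hd : ∀ t : ℝ, HasDerivAt (fun t : ℝ => u (x + t • y)) (fderiv ℝ u (x + t • y) y) t := by
    intro t
    have h1 : HasDerivAt (fun t : ℝ => x + t • y) y t := by
      simpa using ((hasDerivAt_id t).smul_const y).const_add x
    exact ((hu.differentiable one_ne_zero _).hasFDerivAt).comp_hasDerivAt t h1
  have hFTC := intervalIntegral.integral_eq_sub_of_hasDerivAt (a := 0) (b := 1)
    (fun t _ => hd t) (Continuous.intervalIntegrable (by fun_prop) _ _)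
  simp only [one_smul, zero_smul, add_zero] at hFTC
  have h2 : u x = u (x + y) - ∫ t in (0 : ℝ)..1, fderiv ℝ u (x + t • y) y := by
    rw [hFTC]; ring
  rw [h2]
  refine enorm_sub_le.trans ?_
  gcongr
  rw [intervalIntegral.integral_of_le zero_le_one, integral_Ioc_eq_integral_Ioo]
  refine (enorm_integral_le_lintegral_enorm _).trans (lintegral_mono fun t => ?_)
  exact ContinuousLinearMap.le_opENorm _ _

theorem eLpNorm_comp_add_smul {F : Type*} [NormedAddCommGroup F] {g : E³ → F} (hg : Continuous g)
    (x : E³) {t : ℝ} (ht : 0 < t) (q : ℝ≥0∞) :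
    eLpNorm (fun y => g (x + t • y)) q volume =
      ENNReal.ofReal (t ^ (-3 / q.toReal)) * eLpNorm g q volume := by
  have h1 : eLpNorm (fun y => g (x + t • y)) q volume =
      eLpNorm (fun z => g (x + z)) q (Measure.map (fun y : E³ => t • y) volume) := by
    rw [eLpNorm_map_measure (by fun_prop) (by fun_prop)]
    rfl
  have h2 : eLpNorm (fun z => g (x + z)) q volume = eLpNorm g q volume :=
    eLpNorm_comp_measurePreserving hg.aestronglyMeasurable (measurePreserving_add_left volume x)
  rw [h1, Measure.map_addHaar_smul _ ht.ne', eLpNorm_smul_measure_of_ne_zero (by positivity), h2,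
    smul_eq_mul, finrank_euclideanSpace_fin, ENNReal.ofReal_rpow_of_nonneg (by positivity) (by positivity)]
  congr 2
  rw [abs_of_pos (by positivity), ← Real.rpow_natCast, ← Real.rpow_neg ht.le, ← Real.rpow_mul ht.le]
  simp
  ring_nf

theorem morrey_ball {q : ℝ≥0∞} (hq : 3 < q) :
    ∃ K : ℝ≥0, ∀ r : ℝ, 1 ≤ r → ∀ u : E³ → ℝ, ContDiff ℝ 1 u → ∀ x : E³, ∀ R : ℝ, 0 < R →
      ‖u x‖ₑ * volume (Metric.ball (0 : E³) R) ≤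
        eLpNorm u (ENNReal.ofReal r) volume * volume (Metric.ball (0 : E³) R) ^ (1 - 1 / r) +
        K * ENNReal.ofReal R * eLpNorm (fderiv ℝ u) q volume *
          volume (Metric.ball (0 : E³) R) ^ (1 - 1 / q.toReal) := by
  have hq1 : 1 ≤ q := le_trans (by norm_num) hq.le
  have hK : ∫⁻ t in Set.Ioo (0 : ℝ) 1, ENNReal.ofReal (t ^ (-3 / q.toReal)) ≠ ∞ := by
    have : -1 < -3 / q.toReal := by
      rcases eq_or_ne q ∞ with rfl | hq'
      · simp
      · have : 3 < q.toReal := by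
          simpa using (ENNReal.toReal_lt_toReal (by norm_num) hq').2 hq
        rw [lt_div_iff₀ (by linarith)]; linarith
    exact ((intervalIntegral.integrableOn_Ioo_rpow_iff one_pos).2 this).lintegral_lt_top.ne
  refine ⟨(∫⁻ t in Set.Ioo (0 : ℝ) 1, ENNReal.ofReal (t ^ (-3 / q.toReal))).toNNReal,
    fun r hr u hu x R hR => ?_⟩
  rw [ENNReal.coe_toNNReal hK]
  have hcd : Continuous (fderiv ℝ u) := hu.continuous_fderiv one_ne_zero
  have hcu := hu.continuous
  set B := Metric.ball (0 : E³) R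
  have hol : ∀ (p : ℝ≥0∞), 1 ≤ p → ∀ {F : Type} [NormedAddCommGroup F] {f : E³ → F},
      Continuous f → ∫⁻ y in B, ‖f y‖ₑ ≤ eLpNorm f p volume * volume B ^ (1 - 1 / p.toReal) := by
    intro p hp F _ f hf
    have := eLpNorm_le_eLpNorm_mul_rpow_measure_univ (μ := volume.restrict B) hp
      hf.aestronglyMeasurable
    rw [eLpNorm_one_eq_lintegral_enorm] at this
    refine this.trans ?_
    simp only [Measure.restrict_apply_univ, ENNReal.toReal_one, div_one]
    gcongr
    exact Measure.restrict_le_self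
  calc ‖u x‖ₑ * volume B = ∫⁻ y in B, ‖u x‖ₑ := by rw [setLIntegral_const]
    _ ≤ ∫⁻ y in B, (‖u (x + y)‖ₑ +
        ∫⁻ t in Set.Ioo (0 : ℝ) 1, ‖fderiv ℝ u (x + t • y)‖ₑ * ‖y‖ₑ) :=
      lintegral_mono fun y => enorm_le_add_lintegral_fderiv hu x y
    _ = (∫⁻ y in B, ‖u (x + y)‖ₑ) + ∫⁻ y in B,
        ∫⁻ t in Set.Ioo (0 : ℝ) 1, ‖fderiv ℝ u (x + t • y)‖ₑ * ‖y‖ₑ := by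
      exact lintegral_add_left (f := fun y => ‖u (x + y)‖ₑ)
        (hcu.comp (continuous_const_add x)).measurable.enorm _
    _ ≤ _ := ?_
  gcongr
  · refine (hol (ENNReal.ofReal r) (by simpa using hr) (f := fun y => u (x + y))
      (by fun_prop)).trans (le_of_eq ?_)
    rw [ENNReal.toReal_ofReal (by linarith), ← eLpNorm_comp_measurePreserving
      hcu.aestronglyMeasurable (measurePreserving_add_left volume x)]
    rfl
  · calc _ = ∫⁻ t in Set.Ioo (0 : ℝ) 1, ∫⁻ y in B, ‖fderiv ℝ u (x + t • y)‖ₑ * ‖y‖ₑ := by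
          have h1 : Continuous fun z : E³ × ℝ => fderiv ℝ u (x + z.2 • z.1) := by fun_prop
          exact lintegral_lintegral_swap
            (h1.measurable.enorm.mul measurable_fst.enorm).aemeasurable
      _ ≤ ∫⁻ t in Set.Ioo (0 : ℝ) 1, ENNReal.ofReal (t ^ (-3 / q.toReal)) * (ENNReal.ofReal R *
          eLpNorm (fderiv ℝ u) q volume * volume B ^ (1 - 1 / q.toReal)) := by
          refine setLIntegral_mono' measurableSet_Ioo fun t ht => ?_
          calc _ ≤ ∫⁻ y in B, ‖fderiv ℝ u (x + t • y)‖ₑ * ENNReal.ofReal R := by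
                refine setLIntegral_mono' measurableSet_ball fun y hy => ?_
                gcongr
                rw [← ofReal_norm]
                exact ENNReal.ofReal_le_ofReal (mem_ball_zero_iff.1 hy).le
            _ = (∫⁻ y in B, ‖fderiv ℝ u (x + t • y)‖ₑ) * ENNReal.ofReal R :=
                lintegral_mul_const' _ _ ENNReal.ofReal_ne_top
            _ ≤ _ := by
                grw [hol q hq1 (f := fun y => fderiv ℝ u (x + t • y)) (by fun_prop),
                  eLpNorm_comp_add_smul hcd x ht.1]
                apply le_of_eq
                ring
      _ = _ := by
          rw [lintegral_mul_const _ (by fun_prop)]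
          ring

theorem le_rpow_mul_rpow_of_forall_le {α β K M A B : ℝ} (hα : 0 < α) (hβ : 0 < β) (hK : 0 ≤ K)
    (hA : 0 ≤ A) (hB : 0 ≤ B) (h : ∀ R : ℝ, 0 < R → M ≤ K * (R ^ (-α) * A + R ^ β * B)) :
    M ≤ 2 * K * (A ^ (β / (α + β)) * B ^ (α / (α + β))) := by
  have hs : 0 < α + β := by positivity
  have key : ∀ ε : ℝ, 0 < ε →
      M ≤ 2 * K * ((A + ε) ^ (β / (α + β)) * (B + ε) ^ (α / (α + β))) := by
    intro ε hε
    have hA' : 0 < A + ε := by positivity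
    have hB' : 0 < B + ε := by positivity
    refine (h (((A + ε) / (B + ε)) ^ (1 / (α + β))) (by positivity)).trans ?_
    have e1 : (((A + ε) / (B + ε)) ^ (1 / (α + β))) ^ (-α) * (A + ε) =
        (A + ε) ^ (β / (α + β)) * (B + ε) ^ (α / (α + β)) := by
      rw [← Real.rpow_mul (by positivity), Real.div_rpow hA'.le hB'.le,
        show β / (α + β) = 1 / (α + β) * -α + 1 by field_simp; ring, Real.rpow_add_one hA'.ne',
        show α / (α + β) = -(1 / (α + β) * -α) by ring, Real.rpow_neg hB'.le]
      ring
    have e2 : (((A + ε) / (B + ε)) ^ (1 / (α + β))) ^ β * (B + ε) =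
        (A + ε) ^ (β / (α + β)) * (B + ε) ^ (α / (α + β)) := by
      rw [← Real.rpow_mul (by positivity), Real.div_rpow hA'.le hB'.le,
        show 1 / (α + β) * β = β / (α + β) by ring,
        show α / (α + β) = -(β / (α + β)) + 1 by field_simp; ring, Real.rpow_add_one hB'.ne',
        Real.rpow_neg hB'.le]
      ring
    have h3 : ∀ {R : ℝ}, 0 < R → R ^ (-α) * A + R ^ β * B ≤
        R ^ (-α) * (A + ε) + R ^ β * (B + ε) := by
      intro R hR
      gcongr <;> linarith
    grw [h3 (by positivity), e1, e2]
    apply le_of_eq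
    ring
  have hc : ContinuousAt
      (fun ε : ℝ => 2 * K * ((A + ε) ^ (β / (α + β)) * (B + ε) ^ (α / (α + β)))) 0 := by
    refine ContinuousAt.mul continuousAt_const (ContinuousAt.mul ?_ ?_)
    · exact ContinuousAt.rpow_const (by fun_prop) (Or.inr (by positivity))
    · exact ContinuousAt.rpow_const (by fun_prop) (Or.inr (by positivity))
  have ht := hc.tendsto.mono_left (nhdsWithin_le_nhds (s := Set.Ioi 0))
  simp only [add_zero] at ht
  exact ge_of_tendsto ht (Filter.eventually_of_mem self_mem_nhdsWithin fun ε hε => key ε hε)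

theorem exists_eLpNorm_top_le {q : ℝ≥0∞} {r a : ℝ} (hq : 3 < q) (hr : 1 ≤ r)
    (h : 0 = (1 - a) / r + a * (1 / q.toReal - 1 / 3)) :
    ∃ C : ℝ≥0, ∀ u : E³ → ℝ, ContDiff ℝ 1 u → HasCompactSupport u →
      eLpNorm u ∞ volume ≤ C * eLpNorm u (ENNReal.ofReal r) volume ^ (1 - a) *
        eLpNorm (fderiv ℝ u) q volume ^ a := by
  have hr0 : 0 < r := by linarith
  have hβ : 0 < 1 - 3 / q.toReal := by
    rcases eq_or_ne q ∞ with rfl | hq'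
    · simp
    · have : 3 < q.toReal := by
        simpa using (ENNReal.toReal_lt_toReal (by norm_num) hq').2 hq
      rw [sub_pos, div_lt_one (by linarith)]; exact this
  have hα : 0 < 3 / r := by positivity
  have ea : a * (3 / r + (1 - 3 / q.toReal)) = 3 / r := by linear_combination 3 * h
  have ea' : a = 3 / r / (3 / r + (1 - 3 / q.toReal)) :=
    (eq_div_iff (add_pos hα hβ).ne').2 ea
  have ea'' : 1 - a = (1 - 3 / q.toReal) / (3 / r + (1 - 3 / q.toReal)) := by
    rw [eq_div_iff (add_pos hα hβ).ne', sub_mul, ea]; ring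
  have ha0 : 0 < a := ea' ▸ by positivity
  have ha1 : 0 < 1 - a := ea'' ▸ by positivity
  obtain ⟨K, hK⟩ := morrey_ball hq
  set V := (volume (Metric.ball (0 : E³) 1)).toReal with hV
  have hV0 : 0 < V := ENNReal.toReal_pos (Metric.measure_ball_pos _ _ one_pos).ne'
    measure_ball_lt_top.ne
  set L : ℝ := V ^ (-(1 / r)) + K * V ^ (-(1 / q.toReal)) with hL
  have hL0 : 0 ≤ L := by positivity
  refine ⟨(2 * L).toNNReal, fun u hu hcu => ?_⟩
  have hA := (hu.continuous.memLp_of_hasCompactSupport (μ := volume) (p := ENNReal.ofReal r) hcu).2.ne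
  have hB := ((hu.continuous_fderiv one_ne_zero).memLp_of_hasCompactSupport (μ := volume) (p := q)
    (hcu.fderiv ℝ)).2.ne
  rw [eLpNorm_exponent_top]
  refine essSup_le_of_ae_le _ (Filter.Eventually.of_forall fun x => ?_)
  rw [← ENNReal.ofReal_toReal hA, ← ENNReal.ofReal_toReal hB]
  set A := (eLpNorm u (ENNReal.ofReal r) volume).toReal
  set B := (eLpNorm (fderiv ℝ u) q volume).toReal
  have hA0 : 0 ≤ A := ENNReal.toReal_nonneg
  have hB0 : 0 ≤ B := ENNReal.toReal_nonneg
  have main := le_rpow_mul_rpow_of_forall_le (M := ‖u x‖) hα hβ hL0 hA0 hB0 ?_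
  · rw [← ea', ← ea''] at main
    rw [ENNReal.ofReal_rpow_of_nonneg hA0 ha1.le, ENNReal.ofReal_rpow_of_nonneg hB0 ha0.le, mul_assoc,
      ← ENNReal.ofReal_mul (by positivity)]
    change ‖u x‖ₑ ≤ ENNReal.ofReal (2 * L) * _
    rw [← ENNReal.ofReal_mul (by positivity), ← ofReal_norm]
    exact ENNReal.ofReal_le_ofReal main
  intro R hR
  have hball : volume (Metric.ball (0 : E³) R) = ENNReal.ofReal (R ^ 3 * V) := by
    rw [Measure.addHaar_ball _ _ hR.le, finrank_euclideanSpace_fin,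
      ENNReal.ofReal_mul (by positivity), hV, ENNReal.ofReal_toReal measure_ball_lt_top.ne]
  have h1 := hK r hr u hu x R hR
  set v := R ^ 3 * V with hv
  have hv0 : 0 < v := by positivity
  rw [hball, ← ENNReal.ofReal_toReal hA, ← ENNReal.ofReal_toReal hB,
    ENNReal.ofReal_rpow_of_pos hv0, ENNReal.ofReal_rpow_of_pos hv0, ← ENNReal.ofReal_coe_nnreal,
    ← ofReal_norm, ← ENNReal.ofReal_mul (by positivity), ← ENNReal.ofReal_mul (by positivity),
    ← ENNReal.ofReal_mul (by positivity), ← ENNReal.ofReal_mul (by positivity),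
    ← ENNReal.ofReal_mul (by positivity), ← ENNReal.ofReal_add (by positivity) (by positivity),
    ENNReal.ofReal_le_ofReal_iff (by positivity)] at h1
  have hsplit : ∀ s : ℝ, v ^ (1 - s) = v * (R ^ (-3 * s) * V ^ (-s)) := by
    intro s
    rw [sub_eq_add_neg, Real.rpow_add hv0, Real.rpow_one, hv, Real.mul_rpow (by positivity) hV0.le,
      ← Real.rpow_natCast, ← Real.rpow_mul hR.le]
    congr 3
    push_cast
    ring
  rw [hsplit, hsplit] at h1
  have h2 : ‖u x‖ ≤ A * (R ^ (-3 * (1 / r)) * V ^ (-(1 / r))) +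
      K * R * B * (R ^ (-3 * (1 / q.toReal)) * V ^ (-(1 / q.toReal))) :=
    le_of_mul_le_mul_right (h1.trans (le_of_eq (by ring))) hv0
  have e1 : R ^ (-3 * (1 / r)) = R ^ (-(3 / r)) := by congr 1; ring
  have e2 : R ^ (1 - 3 / q.toReal) = R * R ^ (-3 * (1 / q.toReal)) := by
    rw [← Real.rpow_one_add' hR.le]
    · congr 1; ring
    · exact ne_of_gt (by linarith [show -3 * (1 / q.toReal) = -(3 / q.toReal) by ring])
  rw [e1] at h2
  rw [e2, hL]
  refine h2.trans ?_
  have t1 : 0 ≤ R ^ (-(3 / r)) * A * (K * V ^ (-(1 / q.toReal))) := by positivity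
  have t2 : 0 ≤ R * R ^ (-3 * (1 / q.toReal)) * B * V ^ (-(1 / r)) := by positivity
  linarith

theorem gagliardo_nirenberg {p q : ℝ≥0∞} {r a : ℝ} (hp : 1 ≤ p) (hq : 1 ≤ q) (hr : 1 ≤ r)
    (ha0 : 0 ≤ a) (ha1 : a ≤ 1)
    (h : 1 / p.toReal = (1 - a) / r + a * (1 / q.toReal - 1 / 3)) (hpa : p = ∞ → a < 1) :
    ∃ C : ℝ≥0, ∀ u : E³ → ℝ, ContDiff ℝ 1 u → HasCompactSupport u →
      eLpNorm u p volume ≤ C * eLpNorm u (ENNReal.ofReal r) volume ^ (1 - a) *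
        eLpNorm (fderiv ℝ u) q volume ^ a := by
  have hr0 : 0 < r := by linarith
  rcases lt_trichotomy q 3 with hq3 | rfl | hq3
  · have hqt : q ≠ ∞ := hq3.ne_top
    have hq1 : 1 ≤ q.toReal := by simpa using (ENNReal.toReal_le_toReal (by norm_num) hqt).2 hq
    have hq3' : q.toReal < 3 := by simpa using (ENNReal.toReal_lt_toReal hqt (by norm_num)).2 hq3
    have hs : 0 < 1 / q.toReal - 1 / 3 :=
      sub_pos.2 (one_div_lt_one_div_of_lt (by linarith) hq3')
    have hp0 : 0 < 1 / p.toReal := by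
      rw [h]
      rcases ha0.eq_or_lt with rfl | ha
      · simp; positivity
      · have : 0 ≤ 1 - a := by linarith
        positivity
    have hpt : p ≠ ∞ := by rintro rfl; simp at hp0
    obtain ⟨C, hC⟩ := gagliardo_nirenberg_of_lt_three (one_div_pos.1 hp0) hq1 hq3' hr0 ha0 ha1 h
    refine ⟨C, ?_⟩
    rwa [ENNReal.ofReal_toReal hpt, ENNReal.ofReal_toReal hqt] at hC
  · have h' : 1 / p.toReal = (1 - a) / r := by simpa using h
    have hpt : p ≠ ∞ := by
      rintro rfl
      have := div_pos (sub_pos.2 (hpa rfl)) hr0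
      rw [← h'] at this
      simp at this
    have ha1' : a < 1 := by
      refine ha1.lt_of_ne ?_
      rintro rfl
      simp [ENNReal.toReal_eq_zero_iff, hpt] at h'
      simp [h'] at hp
    obtain ⟨C, hC⟩ := gagliardo_nirenberg_three hr0 ha0 ha1' h'
    refine ⟨C, ?_⟩
    rwa [ENNReal.ofReal_toReal hpt, ENNReal.ofReal_ofNat] at hC
  · have hδ : 0 < 1 / 3 - 1 / q.toReal := by
      rcases eq_or_ne q ∞ with rfl | hq'
      · simp
      · have : 3 < q.toReal := by
          simpa using (ENNReal.toReal_lt_toReal (by norm_num) hq').2 hq3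
        exact sub_pos.2 (one_div_lt_one_div_of_lt (by linarith) this)
    rcases eq_or_ne p ∞ with rfl | hpt
    · exact exists_eLpNorm_top_le hq3 hr (by simpa using h)
    have hp1 : 1 ≤ p.toReal := by simpa using (ENNReal.toReal_le_toReal (by norm_num) hpt).2 hp
    have hp0 : 0 < p.toReal := by linarith
    set b := (1 / r) / (1 / r + (1 / 3 - 1 / q.toReal)) with hb
    have hb0 : 0 < b := by positivity
    have hbe : b * (1 / r + (1 / 3 - 1 / q.toReal)) = 1 / r := div_mul_cancel₀ _ (by positivity)
    have hab : a = b * (1 - r / p.toReal) := by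
      have h5 : a * (1 / r + (1 / 3 - 1 / q.toReal)) = 1 / r - 1 / p.toReal := by
        linear_combination h
      apply mul_right_cancel₀ (show 1 / r + (1 / 3 - 1 / q.toReal) ≠ 0 by positivity)
      rw [h5]
      have : 1 / r * (r / p.toReal) = 1 / p.toReal := by field_simp
      linear_combination -(1 - r / p.toReal) * hbe + this
    have hrp : r ≤ p.toReal := by
      have : 0 ≤ 1 - r / p.toReal := by
        by_contra hneg
        nlinarith
      rw [sub_nonneg, div_le_one hp0] at this
      exact this
    have hm0 : 0 ≤ 1 - r / p.toReal := by rw [sub_nonneg, div_le_one hp0]; exact hrp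
    obtain ⟨C, hC⟩ := exists_eLpNorm_top_le (a := b) hq3 hr (by linear_combination hbe)
    refine ⟨C ^ (1 - r / p.toReal), fun u hu hcu => ?_⟩
    have h6 := eLpNorm_le_rpow_mul_rpow_top (f := u) (μ := volume) hr0 hrp
      (hu.continuous.memLp_of_hasCompactSupport hcu).2.ne
    rw [ENNReal.ofReal_toReal hpt] at h6
    refine h6.trans ?_
    grw [hC u hu hcu]
    have hb1 : 0 ≤ 1 - b := by
      rw [hb, sub_nonneg]; exact div_le_one_of_le₀ (by linarith) (by positivity)
    have hrp0 : 0 ≤ r / p.toReal := by positivity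
    rw [ENNReal.mul_rpow_of_nonneg _ _ hm0, ENNReal.mul_rpow_of_nonneg _ _ hm0,
      ENNReal.coe_rpow_of_nonneg _ hm0, ← ENNReal.rpow_mul, ← ENNReal.rpow_mul, ← hab,
      show 1 - a = r / p.toReal + (1 - b) * (1 - r / p.toReal) by rw [hab]; ring,
      ENNReal.rpow_add_of_nonneg _ _ hrp0 (mul_nonneg hb1 hm0)]
    apply le_of_eq
    ring

end GagliardoNirenberg

section Weight

theorem sqrt_one_add_norm_sq_pos {E : Type*} [NormedAddCommGroup E] (x : E) :
    0 < √(1 + ‖x‖ ^ 2) := by positivity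

theorem norm_sq_div_one_add_norm_sq_le {E : Type*} [NormedAddCommGroup E] (x : E) :
    ‖x‖ ^ 2 / (1 + ‖x‖ ^ 2) ≤ 1 := by
  rw [div_le_one (by positivity)]
  linarith

variable {E : Type*} [NormedAddCommGroup E] [InnerProductSpace ℝ E]

theorem contDiff_sqrt_one_add_norm_sq_rpow (s : ℝ) :
    ContDiff ℝ 1 (fun x : E => √(1 + ‖x‖ ^ 2) ^ s) :=
  ((contDiff_const.add (contDiff_norm_sq ℝ)).sqrt fun x => by positivity).rpow_const_of_ne
    fun x => (sqrt_one_add_norm_sq_pos x).ne'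

theorem continuous_sqrt_one_add_norm_sq_rpow (s : ℝ) :
    Continuous (fun x : E => √(1 + ‖x‖ ^ 2) ^ s) :=
  (contDiff_sqrt_one_add_norm_sq_rpow s).continuous

theorem hasFDerivAt_sqrt_one_add_norm_sq_rpow (s : ℝ) (x : E) :
    HasFDerivAt (fun x : E => √(1 + ‖x‖ ^ 2) ^ s)
      ((s * √(1 + ‖x‖ ^ 2) ^ (s - 2)) • innerSL ℝ x) x := by
  have hw := sqrt_one_add_norm_sq_pos x
  have h1 : HasFDerivAt (fun x : E => 1 + ‖x‖ ^ 2) (2 • innerSL ℝ x) x :=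
    (hasStrictFDerivAt_norm_sq x).hasFDerivAt.const_add 1
  have h2 := (h1.sqrt (by positivity)).rpow_const (p := s) (Or.inl hw.ne')
  convert h2 using 1
  rw [show s - 2 = s - 1 - 1 by ring, Real.rpow_sub_one hw.ne' (s - 1)]
  ext h
  simp
  field_simp

/-- The radial map `x ↦ x / w ^ γ`, where `w x = √(1 + ‖x‖ ^ 2)`. -/
noncomputable def radialContraction (γ : ℝ) (x : E) : E := √(1 + ‖x‖ ^ 2) ^ (-γ) • x

/-- The derivative of `radialContraction`. -/
noncomputable def radialContractionDeriv (γ : ℝ) (x : E) : E →L[ℝ] E :=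
  √(1 + ‖x‖ ^ 2) ^ (-γ) •
    (ContinuousLinearMap.id ℝ E + ((-γ / (1 + ‖x‖ ^ 2)) • innerSL ℝ x).smulRight x)

theorem contDiff_radialContraction (γ : ℝ) : ContDiff ℝ 1 (radialContraction γ : E → E) :=
  (contDiff_sqrt_one_add_norm_sq_rpow (-γ)).smul contDiff_id

theorem hasFDerivAt_radialContraction (γ : ℝ) (x : E) :
    HasFDerivAt (radialContraction γ) (radialContractionDeriv γ x) x := by
  have hw := sqrt_one_add_norm_sq_pos x
  refine ((hasFDerivAt_sqrt_one_add_norm_sq_rpow (-γ) x).smul (hasFDerivAt_id x)).congr_fderiv ?_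
  have h1 : √(1 + ‖x‖ ^ 2) ^ (-γ - 2) = √(1 + ‖x‖ ^ 2) ^ (-γ) / (1 + ‖x‖ ^ 2) := by
    rw [Real.rpow_sub hw, Real.rpow_two, Real.sq_sqrt (by positivity)]
  ext1 h
  simp [radialContractionDeriv, h1, smul_smul]
  rw [← neg_smul]
  congr 2
  ring

theorem det_radialContractionDeriv [FiniteDimensional ℝ E] (γ : ℝ) (x : E) :
    (radialContractionDeriv γ x).det =
      (√(1 + ‖x‖ ^ 2) ^ (-γ)) ^ Module.finrank ℝ E * (1 - γ * (‖x‖ ^ 2 / (1 + ‖x‖ ^ 2))) := by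
  have : ((radialContractionDeriv γ x : E →L[ℝ] E) : E →ₗ[ℝ] E) = √(1 + ‖x‖ ^ 2) ^ (-γ) •
      LinearMap.transvection ((-γ / (1 + ‖x‖ ^ 2)) • innerₗ E x) x := by
    ext h
    simp [radialContractionDeriv, LinearMap.transvection]
  rw [ContinuousLinearMap.det, this, LinearMap.det_smul, LinearMap.transvection.det]
  simp
  left
  ring

theorem le_norm_radialContractionDeriv {γ : ℝ} (h0 : 0 ≤ γ) (x h : E) :
    √(1 + ‖x‖ ^ 2) ^ (-γ) * ((1 - γ) * ‖h‖) ≤ ‖radialContractionDeriv γ x h‖ := by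
  have hw := sqrt_one_add_norm_sq_pos x
  simp only [radialContractionDeriv, smul_apply, norm_smul,
    Real.norm_of_nonneg (Real.rpow_nonneg hw.le _)]
  gcongr
  simp only [add_apply, ContinuousLinearMap.id_apply,
    ContinuousLinearMap.smulRight_apply, smul_apply, innerSL_apply_apply]
  have h1 : ‖(-γ / (1 + ‖x‖ ^ 2)) • inner ℝ x h • x‖ ≤ γ * ‖h‖ := by
    rw [norm_smul, norm_smul, norm_div, norm_neg, Real.norm_of_nonneg h0,
      Real.norm_of_nonneg (by positivity : 0 ≤ 1 + ‖x‖ ^ 2)]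
    calc _ ≤ γ / (1 + ‖x‖ ^ 2) * ((‖x‖ * ‖h‖) * ‖x‖) := by
          gcongr; exact norm_inner_le_norm x h
      _ = γ * ‖h‖ * (‖x‖ ^ 2 / (1 + ‖x‖ ^ 2)) := by ring
      _ ≤ γ * ‖h‖ * 1 := by gcongr; exact norm_sq_div_one_add_norm_sq_le x
      _ = _ := mul_one _
  have h2 := norm_sub_norm_le h (-((-γ / (1 + ‖x‖ ^ 2)) • inner ℝ x h • x))
  rw [sub_neg_eq_add, norm_neg] at h2
  rw [smul_eq_mul, ← smul_smul]
  linarith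

theorem norm_radialContraction (γ : ℝ) (x : E) :
    ‖radialContraction γ x‖ = √(1 + ‖x‖ ^ 2) ^ (-γ) * ‖x‖ := by
  rw [radialContraction, norm_smul, Real.norm_of_nonneg (by positivity)]

theorem injective_radialContraction {γ : ℝ} (h1 : γ < 1) :
    Function.Injective (radialContraction γ : E → E) := by
  have hsq : ∀ x : E, ‖radialContraction γ x‖ ^ 2 =
      (1 - 1 / (1 + ‖x‖ ^ 2)) * (1 + ‖x‖ ^ 2) ^ (1 - γ) := by
    intro x
    have hW : 0 < 1 + ‖x‖ ^ 2 := by positivity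
    rw [norm_radialContraction, mul_pow, ← Real.rpow_natCast, ← Real.rpow_mul (Real.sqrt_nonneg _),
      Real.sqrt_eq_rpow, ← Real.rpow_mul hW.le, sub_eq_add_neg 1 γ, Real.rpow_add hW, Real.rpow_one,
      show 1 / 2 * (-γ * ((2 : ℕ) : ℝ)) = -γ by push_cast; ring]
    field_simp
    ring
  have hlt : ∀ x y : E, ‖x‖ < ‖y‖ → ‖radialContraction γ x‖ ^ 2 < ‖radialContraction γ y‖ ^ 2 := by
    intro x y hxy
    rw [hsq, hsq]
    have hs : 1 + ‖x‖ ^ 2 < 1 + ‖y‖ ^ 2 := by gcongr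
    have hx : (0 : ℝ) ≤ 1 - 1 / (1 + ‖x‖ ^ 2) := by
      rw [sub_nonneg, div_le_one (by positivity)]; linarith [sq_nonneg ‖x‖]
    have hd : 1 - 1 / (1 + ‖x‖ ^ 2) < 1 - 1 / (1 + ‖y‖ ^ 2) :=
      sub_lt_sub_left (one_div_lt_one_div_of_lt (by positivity) hs) 1
    have hr : (1 + ‖x‖ ^ 2) ^ (1 - γ) ≤ (1 + ‖y‖ ^ 2) ^ (1 - γ) :=
      Real.rpow_le_rpow (by positivity) hs.le (by linarith)
    calc _ ≤ (1 - 1 / (1 + ‖x‖ ^ 2)) * (1 + ‖y‖ ^ 2) ^ (1 - γ) := by gcongr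
      _ < _ := by gcongr
  intro x y hxy
  have hn : ‖x‖ = ‖y‖ := by
    rcases lt_trichotomy ‖x‖ ‖y‖ with h | h | h
    · exact absurd (hlt _ _ h) (by rw [hxy]; exact lt_irrefl _)
    · exact h
    · exact absurd (hlt _ _ h) (by rw [hxy]; exact lt_irrefl _)
  rw [radialContraction, radialContraction, hn] at hxy
  exact smul_right_injective E (Real.rpow_pos_of_pos (sqrt_one_add_norm_sq_pos y) _).ne' hxy

theorem surjective_radialContraction {γ : ℝ} (h0 : 0 ≤ γ) (h1 : γ < 1) :
    Function.Surjective (radialContraction γ : E → E) := by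
  intro y
  let g : ℝ → ℝ := fun t => √(1 + (t * ‖y‖) ^ 2) ^ (-γ) * t
  have hg : Continuous g :=
    (Continuous.rpow_const (by fun_prop) fun t =>
      Or.inl (Real.sqrt_pos.2 (by positivity)).ne').mul continuous_id
  have hg0 : g 0 = 0 := by simp [g]
  have hlim : Filter.Tendsto (fun t : ℝ => √(1 + ‖y‖ ^ 2) ^ (-γ) * t ^ (1 - γ))
      Filter.atTop Filter.atTop :=
    (tendsto_rpow_atTop (by linarith)).const_mul_atTop
      (Real.rpow_pos_of_pos (sqrt_one_add_norm_sq_pos y) _)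
  obtain ⟨T, hT, hT1⟩ := ((hlim.eventually_ge_atTop 1).and
    (Filter.eventually_ge_atTop 1)).exists
  have hT0 : 0 < T := by linarith
  have hgT : 1 ≤ g T := by
    refine hT.trans ?_
    have e1 : √(1 + (T * ‖y‖) ^ 2) ≤ T * √(1 + ‖y‖ ^ 2) := by
      rw [← Real.sqrt_sq hT0.le, ← Real.sqrt_mul (by positivity), Real.sqrt_sq hT0.le]
      apply Real.sqrt_le_sqrt
      nlinarith
    have e2 : T ^ (1 - γ) = T ^ (-γ) * T := by
      rw [← Real.rpow_add_one hT0.ne']; congr 1; ring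
    have e3 := Real.rpow_le_rpow_of_nonpos (Real.sqrt_pos.2 (by positivity)) e1
      (by linarith : -γ ≤ 0)
    rw [Real.mul_rpow hT0.le (by positivity)] at e3
    rw [e2]
    calc _ = T ^ (-γ) * √(1 + ‖y‖ ^ 2) ^ (-γ) * T := by ring
      _ ≤ _ := mul_le_mul_of_nonneg_right e3 hT0.le
  obtain ⟨t, ht, hgt⟩ := intermediate_value_Icc hT0.le hg.continuousOn
    (show (1 : ℝ) ∈ Set.Icc (g 0) (g T) from ⟨by simp [hg0], hgT⟩)
  refine ⟨t • y, ?_⟩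
  rw [radialContraction, smul_smul, norm_smul, Real.norm_of_nonneg ht.1]
  change g t • y = y
  rw [hgt, one_smul]

variable [FiniteDimensional ℝ E] {γ : ℝ}

theorem det_radialContractionDeriv_le (h0 : 0 ≤ γ) (x : E) :
    (radialContractionDeriv γ x).det ≤ (√(1 + ‖x‖ ^ 2) ^ (-γ)) ^ Module.finrank ℝ E := by
  rw [det_radialContractionDeriv]
  refine mul_le_of_le_one_right (by positivity) ?_
  have : 0 ≤ γ * (‖x‖ ^ 2 / (1 + ‖x‖ ^ 2)) := by positivity
  linarith

theorem le_det_radialContractionDeriv (h0 : 0 ≤ γ) (x : E) :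
    (√(1 + ‖x‖ ^ 2) ^ (-γ)) ^ Module.finrank ℝ E * (1 - γ) ≤ (radialContractionDeriv γ x).det := by
  rw [det_radialContractionDeriv]
  gcongr
  exact mul_le_of_le_one_right h0 (norm_sq_div_one_add_norm_sq_le x)

theorem det_radialContractionDeriv_pos (h0 : 0 ≤ γ) (h1 : γ < 1) (x : E) :
    0 < (radialContractionDeriv γ x).det := by
  refine lt_of_lt_of_le ?_ (le_det_radialContractionDeriv h0 x)
  have := sub_pos.2 h1
  positivity

/-- The derivative of `radialContraction`, as a continuous linear equivalence. -/
noncomputable def radialContractionDerivEquiv (h0 : 0 ≤ γ) (h1 : γ < 1) (x : E) : E ≃L[ℝ] E :=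
  (radialContractionDeriv γ x).toContinuousLinearEquivOfDetNeZero
    (det_radialContractionDeriv_pos h0 h1 x).ne'

theorem coe_radialContractionDerivEquiv (h0 : 0 ≤ γ) (h1 : γ < 1) (x : E) :
    (radialContractionDerivEquiv h0 h1 x : E →L[ℝ] E) = radialContractionDeriv γ x :=
  ContinuousLinearMap.coe_toContinuousLinearEquivOfDetNeZero _ _

/-- The homeomorphism of `E` given by `radialContraction`. -/
noncomputable def radialHomeomorph (h0 : 0 ≤ γ) (h1 : γ < 1) : E ≃ₜ E :=
  (Equiv.ofBijective (radialContraction γ : E → E)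
    ⟨injective_radialContraction h1, surjective_radialContraction h0 h1⟩).toHomeomorphOfContinuousOpen
    (contDiff_radialContraction γ).continuous
    (isOpenMap_of_hasStrictFDerivAt_equiv (f' := radialContractionDerivEquiv h0 h1) fun x => by
      rw [coe_radialContractionDerivEquiv]
      exact (contDiff_radialContraction γ).contDiffAt.hasStrictFDerivAt'
        (hasFDerivAt_radialContraction γ x) one_ne_zero)

theorem coe_radialHomeomorph (h0 : 0 ≤ γ) (h1 : γ < 1) :
    ⇑(radialHomeomorph h0 h1 : E ≃ₜ E) = radialContraction γ := rfl

theorem contDiff_radialHomeomorph_symm (h0 : 0 ≤ γ) (h1 : γ < 1) :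
    ContDiff ℝ 1 (radialHomeomorph h0 h1 : E ≃ₜ E).symm := by
  refine (radialHomeomorph h0 h1).contDiff_symm (f₀' := radialContractionDerivEquiv h0 h1)
    (fun x => ?_) (contDiff_radialContraction γ)
  rw [coe_radialContractionDerivEquiv]
  exact hasFDerivAt_radialContraction γ x

end Weight

section WeightedMeasure

variable {α : Type*} [MeasurableSpace α] {μ : Measure α}

theorem eLpNorm_withDensity_ofReal {f g : α → ℝ} (hg : Measurable g) (hg0 : ∀ x, 0 < g x)
    {p : ℝ≥0∞} (hp : p ≠ 0) :
    eLpNorm f p (μ.withDensity fun x => ENNReal.ofReal (g x)) =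
      eLpNorm (fun x => g x ^ (1 / p.toReal) * f x) p μ := by
  have hm : Measurable fun x => ENNReal.ofReal (g x) := hg.ennreal_ofReal
  rcases eq_or_ne p ∞ with rfl | hp'
  · simp only [eLpNorm_exponent_top, ENNReal.toReal_top, div_zero, Real.rpow_zero, one_mul,
      eLpNormEssSup]
    exact le_antisymm (essSup_mono_measure (withDensity_absolutelyContinuous _ _))
      (essSup_mono_measure (withDensity_absolutelyContinuous' hm.aemeasurable
        (.of_forall fun x => (ENNReal.ofReal_pos.2 (hg0 x)).ne')))
  · have hpos := ENNReal.toReal_pos hp hp'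
    rw [eLpNorm_eq_lintegral_rpow_enorm_toReal hp hp', eLpNorm_eq_lintegral_rpow_enorm_toReal hp hp',
      lintegral_withDensity_eq_lintegral_mul_non_measurable _ hm
        (.of_forall fun x => ENNReal.ofReal_lt_top)]
    congr 2 with x
    rw [Pi.mul_apply, enorm_mul, ENNReal.mul_rpow_of_nonneg _ _ hpos.le,
      Real.enorm_of_nonneg (Real.rpow_nonneg (hg0 x).le _),
      ENNReal.ofReal_rpow_of_nonneg (Real.rpow_nonneg (hg0 x).le _) hpos.le,
      ← Real.rpow_mul (hg0 x).le, one_div_mul_cancel hpos.ne', Real.rpow_one]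

end WeightedMeasure

section WeightedGagliardoNirenberg

local notation "E³" => EuclideanSpace ℝ (Fin 3)

/-- The measure on `ℝ³` with density `w ^ (-3 γ)`, where `w x = √(1 + ‖x‖ ^ 2)`. -/
noncomputable def radialMeasure (γ : ℝ) : Measure E³ :=
  volume.withDensity fun x => ENNReal.ofReal ((√(1 + ‖x‖ ^ 2) ^ (-γ)) ^ 3)

theorem eLpNorm_radialMeasure (γ : ℝ) (f : E³ → ℝ) {p : ℝ≥0∞} (hp : p ≠ 0) :
    eLpNorm f p (radialMeasure γ) =
      eLpNorm (fun x => √(1 + ‖x‖ ^ 2) ^ (-(3 / p.toReal) * γ) * f x) p volume := by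
  rw [radialMeasure, eLpNorm_withDensity_ofReal (g := fun x : E³ => (√(1 + ‖x‖ ^ 2) ^ (-γ)) ^ 3)
    ((continuous_sqrt_one_add_norm_sq_rpow (-γ)).pow 3).measurable (fun x => by positivity) hp]
  congr with x
  rw [← Real.rpow_natCast, ← Real.rpow_mul (by positivity), ← Real.rpow_mul (by positivity)]
  congr 2
  push_cast
  ring

variable {γ : ℝ}

theorem withDensity_det_le_radialMeasure (h0 : 0 ≤ γ) (h1 : γ < 1) :
    (volume.withDensity fun x : E³ => ENNReal.ofReal |(radialContractionDeriv γ x).det|) ≤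
      radialMeasure γ := by
  refine withDensity_mono (.of_forall fun x => ENNReal.ofReal_le_ofReal ?_)
  rw [abs_of_pos (det_radialContractionDeriv_pos h0 h1 x)]
  simpa using det_radialContractionDeriv_le h0 x

theorem radialMeasure_le_smul_withDensity_det (h0 : 0 ≤ γ) (h1 : γ < 1) :
    radialMeasure γ ≤ ENNReal.ofReal (1 - γ)⁻¹ •
      volume.withDensity fun x : E³ => ENNReal.ofReal |(radialContractionDeriv γ x).det| := by
  rw [← withDensity_smul' _ _ ENNReal.ofReal_ne_top]
  refine withDensity_mono (.of_forall fun x => ?_)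
  have h := sub_pos.2 h1
  rw [Pi.smul_apply, smul_eq_mul, ← ENNReal.ofReal_mul (by positivity),
    abs_of_pos (det_radialContractionDeriv_pos h0 h1 x)]
  apply ENNReal.ofReal_le_ofReal
  rw [inv_mul_eq_div, le_div_iff₀ h]
  simpa using le_det_radialContractionDeriv h0 x

theorem eLpNorm_comp_radialContraction {F : Type*} [NormedAddCommGroup F]
    [SecondCountableTopology F] (h0 : 0 ≤ γ) (h1 : γ < 1) {f : E³ → F}
    (hf : Continuous f) (p : ℝ≥0∞) :
    eLpNorm (f ∘ radialContraction γ) p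
      (volume.withDensity fun x : E³ => ENNReal.ofReal |(radialContractionDeriv γ x).det|) =
      eLpNorm f p volume := by
  have hmap := map_withDensity_abs_det_fderiv_eq_addHaar (volume : Measure E³)
    MeasurableSet.univ.nullMeasurableSet
    (fun x _ => (hasFDerivAt_radialContraction γ x).hasFDerivWithinAt)
    (injective_radialContraction h1).injOn
  rw [Set.image_univ, (surjective_radialContraction h0 h1).range_eq, Measure.restrict_univ] at hmap
  rw [← eLpNorm_map_measure hf.aestronglyMeasurable
    (contDiff_radialContraction γ).continuous.aemeasurable, hmap]

theorem norm_fderiv_comp_radialHomeomorph_symm_le (h0 : 0 ≤ γ) (h1 : γ < 1) {v : E³ → ℝ}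
    (hv : Differentiable ℝ v) (x : E³) :
    ‖fderiv ℝ (v ∘ (radialHomeomorph h0 h1).symm) (radialContraction γ x)‖ ≤
      (1 - γ)⁻¹ * (√(1 + ‖x‖ ^ 2) ^ γ * ‖fderiv ℝ v x‖) := by
  set v' := v ∘ (radialHomeomorph h0 h1 : E³ ≃ₜ E³).symm with hv'
  have h := sub_pos.2 h1
  have hd : Differentiable ℝ v' :=
    hv.comp ((contDiff_radialHomeomorph_symm h0 h1).differentiable one_ne_zero)
  have hcomp : v = v' ∘ radialContraction γ := by
    ext y
    simp [hv', ← coe_radialHomeomorph h0 h1]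
  have hchain : fderiv ℝ v x =
      (fderiv ℝ v' (radialContraction γ x)).comp (radialContractionDeriv γ x) := by
    conv_lhs => rw [hcomp]
    exact ((hd _).hasFDerivAt.comp x (hasFDerivAt_radialContraction γ x)).fderiv
  refine ContinuousLinearMap.opNorm_le_bound _ (by positivity) fun k => ?_
  obtain ⟨l, rfl⟩ : ∃ l, radialContractionDeriv γ x l = k := by
    refine ⟨(radialContractionDerivEquiv h0 h1 x).symm k, ?_⟩
    rw [← coe_radialContractionDerivEquiv h0 h1]
    simp
  have e1 : fderiv ℝ v' (radialContraction γ x) (radialContractionDeriv γ x l) =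
      fderiv ℝ v x l := by rw [hchain]; rfl
  rw [e1]
  have e2 : ‖l‖ ≤ (1 - γ)⁻¹ * √(1 + ‖x‖ ^ 2) ^ γ * ‖radialContractionDeriv γ x l‖ := by
    calc ‖l‖ = (1 - γ)⁻¹ * √(1 + ‖x‖ ^ 2) ^ γ *
          (√(1 + ‖x‖ ^ 2) ^ (-γ) * ((1 - γ) * ‖l‖)) := by
          rw [Real.rpow_neg (by positivity)]
          field_simp
      _ ≤ _ := by gcongr; exact le_norm_radialContractionDeriv h0 x l
  calc _ ≤ ‖fderiv ℝ v x‖ * ‖l‖ := ContinuousLinearMap.le_opNorm _ _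
    _ ≤ _ := mul_le_mul_of_nonneg_left e2 (norm_nonneg _)
    _ = _ := by ring

theorem gagliardo_nirenberg_radialMeasure (h0 : 0 ≤ γ) (h1 : γ < 1) {p q : ℝ≥0∞} {r a : ℝ}
    (hp : 1 ≤ p) (hq : 1 ≤ q) (hr : 1 ≤ r) (ha0 : 0 ≤ a) (ha1 : a ≤ 1)
    (h : 1 / p.toReal = (1 - a) / r + a * (1 / q.toReal - 1 / 3)) (hpa : p = ∞ → a < 1) :
    ∃ C : ℝ≥0, ∀ v : E³ → ℝ, ContDiff ℝ 1 v → HasCompactSupport v →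
      eLpNorm v p (radialMeasure γ) ≤
        C * eLpNorm v (ENNReal.ofReal r) (radialMeasure γ) ^ (1 - a) *
          eLpNorm (fun x => √(1 + ‖x‖ ^ 2) ^ γ * ‖fderiv ℝ v x‖) q (radialMeasure γ) ^ a := by
  obtain ⟨C, hC⟩ := gagliardo_nirenberg hp hq hr ha0 ha1 h hpa
  have hpos := sub_pos.2 h1
  set δ : ℝ≥0 := (1 - γ)⁻¹.toNNReal with hδ
  have hδ' : ENNReal.ofReal (1 - γ)⁻¹ = δ := rfl
  have hδ0 : δ ≠ 0 := by simpa [hδ] using h1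
  refine ⟨δ ^ (1 / p).toReal * C * δ ^ a, fun v hv hvs => ?_⟩
  set v' := v ∘ (radialHomeomorph h0 h1 : E³ ≃ₜ E³).symm with hv'
  have hd : ContDiff ℝ 1 v' := hv.comp (contDiff_radialHomeomorph_symm h0 h1)
  have hcomp : v' ∘ radialContraction γ = v := by
    ext y
    simp [hv', ← coe_radialHomeomorph h0 h1]
  have hGN := hC v' hd (hvs.comp_homeomorph _)
  rw [← eLpNorm_comp_radialContraction h0 h1 hd.continuous,
    ← eLpNorm_comp_radialContraction h0 h1 hd.continuous,
    ← eLpNorm_comp_radialContraction h0 h1 (hd.continuous_fderiv one_ne_zero), hcomp] at hGN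
  set μ : Measure E³ :=
    volume.withDensity fun x : E³ => ENNReal.ofReal |(radialContractionDeriv γ x).det| with hμ
  have hle := withDensity_det_le_radialMeasure h0 h1
  have hgrad : eLpNorm (fderiv ℝ v' ∘ radialContraction γ) q μ ≤
      δ * eLpNorm (fun x => √(1 + ‖x‖ ^ 2) ^ γ * ‖fderiv ℝ v x‖) q (radialMeasure γ) := by
    refine (eLpNorm_mono_measure _ hle).trans ?_
    refine (eLpNorm_le_mul_eLpNorm_of_ae_le_mul (c := (1 - γ)⁻¹) (.of_forall fun x => ?_) q).trans
      (le_of_eq rfl)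
    rw [Real.norm_of_nonneg (by positivity)]
    exact norm_fderiv_comp_radialHomeomorph_symm_le h0 h1 (hv.differentiable one_ne_zero) x
  have hδp : ((δ ^ (1 / p).toReal : ℝ≥0) : ℝ≥0∞) = (δ : ℝ≥0∞) ^ (1 / p).toReal :=
    ENNReal.coe_rpow_of_ne_zero hδ0 _
  have hδa : ((δ ^ a : ℝ≥0) : ℝ≥0∞) = (δ : ℝ≥0∞) ^ a := ENNReal.coe_rpow_of_ne_zero hδ0 _
  calc eLpNorm v p (radialMeasure γ) ≤ eLpNorm v p ((δ : ℝ≥0∞) • μ) :=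
        eLpNorm_mono_measure _ (radialMeasure_le_smul_withDensity_det h0 h1)
    _ ≤ (δ : ℝ≥0∞) ^ (1 / p).toReal * eLpNorm v p μ := eLpNorm_smul_measure_le _ _ _ _
    _ ≤ (δ : ℝ≥0∞) ^ (1 / p).toReal * (C * eLpNorm v (ENNReal.ofReal r) (radialMeasure γ) ^ (1 - a) *
        (δ * eLpNorm (fun x => √(1 + ‖x‖ ^ 2) ^ γ * ‖fderiv ℝ v x‖) q (radialMeasure γ)) ^ a) := by
      gcongr
      refine hGN.trans ?_
      gcongr
    _ = _ := by
      rw [ENNReal.mul_rpow_of_nonneg _ _ ha0]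
      push_cast
      rw [hδp, hδa]
      ring

theorem sum_smul_single_eq (h : E³) : ∑ k, h k • EuclideanSpace.single k (1 : ℝ) = h := by
  simpa using (EuclideanSpace.basisFun (Fin 3) ℝ).sum_repr h

theorem norm_le_sqrt_sum_apply_single_sq (L : E³ →L[ℝ] ℝ) :
    ‖L‖ ≤ √(∑ k : Fin 3, L (EuclideanSpace.single k 1) ^ 2) := by
  refine ContinuousLinearMap.opNorm_le_bound _ (Real.sqrt_nonneg _) fun h => ?_
  have hL : L h = ∑ k, L (EuclideanSpace.single k 1) * h k := by
    conv_lhs => rw [← sum_smul_single_eq h]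
    simp [map_sum, mul_comm]
  rw [Real.norm_eq_abs, EuclideanSpace.norm_eq, hL]
  simp only [Real.norm_eq_abs, sq_abs]
  rw [← Real.sqrt_mul (by positivity)]
  apply Real.abs_le_sqrt
  simpa using Finset.sum_mul_sq_le_sq_mul_sq Finset.univ
    (fun k => L (EuclideanSpace.single k 1)) (fun k => h k)

theorem norm_le_sqrt_one_add_norm_sq {E : Type*} [NormedAddCommGroup E] (x : E) :
    ‖x‖ ≤ √(1 + ‖x‖ ^ 2) := Real.le_sqrt_of_sq_le (by linarith)

theorem norm_fderiv_sqrt_one_add_norm_sq_rpow_mul_le (β : ℝ) {u : E³ → ℝ} {x : E³}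
    (hu : DifferentiableAt ℝ u x) :
    ‖fderiv ℝ (fun y => √(1 + ‖y‖ ^ 2) ^ β * u y) x‖ ≤
      √(1 + ‖x‖ ^ 2) ^ β * √(∑ k : Fin 3, fderiv ℝ u x (EuclideanSpace.single k 1) ^ 2) +
        |β| * (√(1 + ‖x‖ ^ 2) ^ (β - 1) * ‖u x‖) := by
  have hw := sqrt_one_add_norm_sq_pos x
  have hd : HasFDerivAt (fun y => √(1 + ‖y‖ ^ 2) ^ β * u y) _ x :=
    (hasFDerivAt_sqrt_one_add_norm_sq_rpow β x).mul hu.hasFDerivAt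
  rw [hd.fderiv]
  refine (norm_add_le _ _).trans (add_le_add ?_ ?_)
  · rw [norm_smul, Real.norm_of_nonneg (by positivity)]
    gcongr
    exact norm_le_sqrt_sum_apply_single_sq _
  · rw [norm_smul, norm_smul, norm_mul, Real.norm_of_nonneg (Real.rpow_nonneg hw.le _),
      innerSL_apply_norm, Real.norm_eq_abs β]
    have e : √(1 + ‖x‖ ^ 2) ^ (β - 2) * √(1 + ‖x‖ ^ 2) = √(1 + ‖x‖ ^ 2) ^ (β - 1) := by
      rw [← Real.rpow_add_one hw.ne']; congr 1; ring
    calc _ ≤ ‖u x‖ * (|β| * √(1 + ‖x‖ ^ 2) ^ (β - 2) * √(1 + ‖x‖ ^ 2)) := by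
          gcongr; exact norm_le_sqrt_one_add_norm_sq x
      _ = _ := by rw [← e]; ring

theorem eLpNorm_radialMeasure_fderiv_rpow_mul_le (γ β : ℝ) {q : ℝ≥0∞} (hq : 1 ≤ q) {u : E³ → ℝ}
    (hu : ContDiff ℝ 1 u) :
    eLpNorm (fun x => √(1 + ‖x‖ ^ 2) ^ γ *
        ‖fderiv ℝ (fun y => √(1 + ‖y‖ ^ 2) ^ β * u y) x‖) q (radialMeasure γ) ≤
      eLpNorm (fun x : E³ => √(1 + ‖x‖ ^ 2) ^ (β + (1 - 3 / q.toReal) * γ) *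
          √(∑ k : Fin 3, fderiv ℝ u x (EuclideanSpace.single k 1) ^ 2)) q volume +
        ENNReal.ofReal |β| * eLpNorm (fun x : E³ =>
          √(1 + ‖x‖ ^ 2) ^ (β - 1 + (1 - 3 / q.toReal) * γ) * u x) q volume := by
  have hcont : Continuous fun x : E³ =>
      √(∑ k : Fin 3, fderiv ℝ u x (EuclideanSpace.single k 1) ^ 2) := by
    have := hu.continuous_fderiv one_ne_zero
    fun_prop
  set F : E³ → ℝ := fun x => √(1 + ‖x‖ ^ 2) ^ (β + (1 - 3 / q.toReal) * γ) *
    √(∑ k : Fin 3, fderiv ℝ u x (EuclideanSpace.single k 1) ^ 2) with hF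
  set G : E³ → ℝ := fun x => √(1 + ‖x‖ ^ 2) ^ (β - 1 + (1 - 3 / q.toReal) * γ) * u x with hG
  have hFc : Continuous F := (continuous_sqrt_one_add_norm_sq_rpow _).mul hcont
  have hGc : Continuous G := (continuous_sqrt_one_add_norm_sq_rpow _).mul hu.continuous
  rw [eLpNorm_radialMeasure γ _ (zero_lt_one.trans_le hq).ne']
  calc _ ≤ eLpNorm (F + |β| • fun x => ‖G x‖) q volume := ?_
    _ ≤ eLpNorm F q volume + eLpNorm (|β| • fun x => ‖G x‖) q volume :=
      eLpNorm_add_le hFc.aestronglyMeasurable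
        (hGc.norm.const_smul |β|).aestronglyMeasurable hq
    _ = _ := by
      rw [eLpNorm_const_smul, eLpNorm_norm, Real.enorm_of_nonneg (abs_nonneg β)]
  refine eLpNorm_mono_real fun x => ?_
  have hw := sqrt_one_add_norm_sq_pos x
  rw [Real.norm_of_nonneg (by positivity)]
  have e1 : √(1 + ‖x‖ ^ 2) ^ (β + (1 - 3 / q.toReal) * γ) =
      √(1 + ‖x‖ ^ 2) ^ (-(3 / q.toReal) * γ) * (√(1 + ‖x‖ ^ 2) ^ γ * √(1 + ‖x‖ ^ 2) ^ β) := by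
    rw [← Real.rpow_add hw, ← Real.rpow_add hw]; congr 1; ring
  have e2 : √(1 + ‖x‖ ^ 2) ^ (β - 1 + (1 - 3 / q.toReal) * γ) =
      √(1 + ‖x‖ ^ 2) ^ (-(3 / q.toReal) * γ) *
        (√(1 + ‖x‖ ^ 2) ^ γ * √(1 + ‖x‖ ^ 2) ^ (β - 1)) := by
    rw [← Real.rpow_add hw, ← Real.rpow_add hw]; congr 1; ring
  calc _ ≤ √(1 + ‖x‖ ^ 2) ^ (-(3 / q.toReal) * γ) * (√(1 + ‖x‖ ^ 2) ^ γ *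
        (√(1 + ‖x‖ ^ 2) ^ β * √(∑ k : Fin 3, fderiv ℝ u x (EuclideanSpace.single k 1) ^ 2) +
          |β| * (√(1 + ‖x‖ ^ 2) ^ (β - 1) * ‖u x‖))) := by
        gcongr
        exact norm_fderiv_sqrt_one_add_norm_sq_rpow_mul_le β
          (hu.differentiable one_ne_zero).differentiableAt
    _ = _ := by
        simp only [hF, hG, Pi.add_apply, Pi.smul_apply, smul_eq_mul, norm_mul, e1, e2,
          Real.norm_of_nonneg (Real.rpow_nonneg hw.le _)]
        ring

theorem eLpNorm_radialMeasure_rpow_mul (γ β : ℝ) (u : E³ → ℝ) {p : ℝ≥0∞} (hp : p ≠ 0) :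
    eLpNorm (fun x => √(1 + ‖x‖ ^ 2) ^ β * u x) p (radialMeasure γ) =
      eLpNorm (fun x => √(1 + ‖x‖ ^ 2) ^ (β - 3 / p.toReal * γ) * u x) p volume := by
  rw [eLpNorm_radialMeasure γ _ hp]
  congr with x
  rw [← mul_assoc, ← Real.rpow_add (sqrt_one_add_norm_sq_pos x)]
  congr 2
  ring

end WeightedGagliardoNirenberg

/-- The weighted Gagliardo–Nirenberg interpolation inequality of Section 5.3
(the conventions `1/p.toReal = 0`, `3/q.toReal = 0` for `p, q = ∞` reproduce the
usual exponents). -/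
theorem weighted_gagliardo_nirenberg (σ β : ℝ) (hσ : 0 < σ) (hσ1 : σ ≤ 1)
    (r : ℝ) (hr : 1 ≤ r) (p q : ℝ≥0∞) (hp : 1 ≤ p) (hq : 1 ≤ q)
    (a : ℝ) (ha0 : 0 ≤ a) (ha1 : a ≤ 1)
    (hrel : 1 / p.toReal = (1 - a) / r + a * (1 / q.toReal - 1 / 3))
    (hpa : p = ∞ → a < 1) :
    ∃ C > 0, ∀ u : EuclideanSpace ℝ (Fin 3) → ℝ,
      ContDiff ℝ 1 u → HasCompactSupport u →
      eLpNorm (fun x : EuclideanSpace ℝ (Fin 3) =>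
          Real.sqrt (1 + ‖x‖ ^ 2) ^ (β - (3 / p.toReal) * (1 - σ)) * u x) p volume
        ≤ ENNReal.ofReal C *
          (eLpNorm (fun x : EuclideanSpace ℝ (Fin 3) =>
              Real.sqrt (1 + ‖x‖ ^ 2) ^ (β - (3 / r) * (1 - σ)) * u x)
            (ENNReal.ofReal r) volume) ^ (1 - a) *
          (eLpNorm (fun x : EuclideanSpace ℝ (Fin 3) =>
              Real.sqrt (1 + ‖x‖ ^ 2) ^ (β + (1 - 3 / q.toReal) * (1 - σ)) *
                Real.sqrt (∑ k : Fin 3,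
                  (fderiv ℝ u x (EuclideanSpace.single k 1)) ^ 2)) q volume
            + ENNReal.ofReal |β| *
              eLpNorm (fun x : EuclideanSpace ℝ (Fin 3) =>
                Real.sqrt (1 + ‖x‖ ^ 2) ^ (β - 1 + (1 - 3 / q.toReal) * (1 - σ)) * u x)
                q volume) ^ a := by
  have h0 : 0 ≤ 1 - σ := by linarith
  have h1 : 1 - σ < 1 := by linarith
  obtain ⟨C, hC⟩ := gagliardo_nirenberg_radialMeasure h0 h1 hp hq hr ha0 ha1 hrel hpa
  refine ⟨C + 1, by positivity, fun u hu hus => ?_⟩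
  have hGN := hC _ ((contDiff_sqrt_one_add_norm_sq_rpow β).mul hu) hus.mul_left
  have hr0 : ENNReal.ofReal r ≠ 0 := by simpa using by linarith
  rw [eLpNorm_radialMeasure_rpow_mul _ _ _ (zero_lt_one.trans_le hp).ne',
    eLpNorm_radialMeasure_rpow_mul _ _ _ hr0, ENNReal.toReal_ofReal (by linarith)] at hGN
  refine hGN.trans ?_
  gcongr
  · rw [← ENNReal.ofReal_coe_nnreal]
    exact ENNReal.ofReal_le_ofReal (by linarith)
  · exact eLpNorm_radialMeasure_fderiv_rpow_mul_le _ _ hq hu
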